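/- arXiv:2601.10993 — 2 statements merged into one kernel-verified Lean document; each statement's English description precedes it below -/
import Mathlib

section
/- Let ℙ_i be a probability measure on a measurable space 𝒳 and let l : 𝒳 → [0,1] be measurable with R = E_{X∼ℙ_i}[l(X)] > 0. If there is a constant 0 < c < 1 such that E_{X∼ℙ_i}[√(l(X))] ≤ (1−c)·√R, then ℙ_i({x : l(x) ≤ R}) ≥ c. -/
open MeasureTheory

/-- under the uniform-margin condition
`E[√(l(X))] ≤ (1−c)·√R` with `R = E[l(X)] > 0`, we have `ℙ_i(l(X) ≤ R) ≥ c`. -/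
theorem stmt_7 {𝒳 : Type*} [MeasurableSpace 𝒳]
    (Pi : Measure 𝒳) [IsProbabilityMeasure Pi]
    (l : 𝒳 → ℝ) (hl_meas : Measurable l) (hl_bdd : ∀ x, l x ∈ Set.Icc (0 : ℝ) 1)
    (R : ℝ) (hR : R = ∫ x, l x ∂Pi) (hRpos : 0 < R)
    (c : ℝ) (hc0 : 0 < c) (hc1 : c < 1)
    (hmargin : ∫ x, Real.sqrt (l x) ∂Pi ≤ (1 - c) * Real.sqrt R) :
    ENNReal.ofReal c ≤ Pi {x | l x ≤ R} := by
  have hint : Integrable (fun x => Real.sqrt (l x)) Pi := by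
    refine Integrable.of_bound (C := 1) hl_meas.sqrt.aestronglyMeasurable ?_
    refine Filter.Eventually.of_forall fun x => ?_
    rw [Real.norm_of_nonneg (Real.sqrt_nonneg _)]
    exact Real.sqrt_le_one.mpr (hl_bdd x).2
  have hM := mul_meas_ge_le_integral_of_nonneg
    (Filter.Eventually.of_forall fun x => Real.sqrt_nonneg (l x)) hint (Real.sqrt R)
  have hs : 0 < Real.sqrt R := Real.sqrt_pos.mpr hRpos
  have h1 : Pi.real {x | Real.sqrt R ≤ Real.sqrt (l x)} ≤ 1 - c := by
    refine le_of_mul_le_mul_left ?_ hs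
    linarith [mul_comm (1 - c) (Real.sqrt R)]
  have hms : MeasurableSet {x | l x ≤ R} := measurableSet_le hl_meas measurable_const
  have h2 : Pi.real {x | l x ≤ R}ᶜ ≤ Pi.real {x | Real.sqrt R ≤ Real.sqrt (l x)} := by
    refine measureReal_mono fun x hx => ?_
    simp only [Set.mem_compl_iff, Set.mem_setOf_eq, not_le] at hx ⊢
    exact Real.sqrt_le_sqrt hx.le
  have h3 : Pi.real {x | l x ≤ R}ᶜ = 1 - Pi.real {x | l x ≤ R} := probReal_compl_eq_one_sub hms
  refine ENNReal.ofReal_le_of_le_toReal ?_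
  change c ≤ Pi.real {x | l x ≤ R}
  linarith
end

section
/- Let f : ℝ^p → ℝ be differentiable with L-Lipschitz gradient for some L > 0. Then for any θ, g ∈ ℝ^p, any η > 0, and θ' = θ − η·g, f(θ') − f(θ) ≤ (η/2)·‖∇f(θ) − g‖² − (η/2)·(‖∇f(θ)‖² + (1 − η·L)·‖g‖²). -/
/-- descent-lemma upper bound for one gradient-style step
`θ' = θ − η·g` of a function with `L`-Lipschitz gradient. -/
theorem stmt_10 {p : ℕ} (f : EuclideanSpace ℝ (Fin p) → ℝ) (L : ℝ) (hL : 0 < L)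
    (hdiff : Differentiable ℝ f)
    (hlip : ∀ θ θ' : EuclideanSpace ℝ (Fin p),
      ‖gradient f θ - gradient f θ'‖ ≤ L * ‖θ - θ'‖)
    (θ g : EuclideanSpace ℝ (Fin p)) (η : ℝ) (hη : 0 < η) :
    f (θ - η • g) - f θ ≤
      (η / 2) * ‖gradient f θ - g‖ ^ 2 -
        (η / 2) * (‖gradient f θ‖ ^ 2 + (1 - η * L) * ‖g‖ ^ 2) := by
  have hc : ∀ t : ℝ, HasDerivAt (fun t : ℝ => f (θ - t • g))
      (-(inner ℝ (gradient f (θ - t • g)) g)) t := by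
    intro t
    have h1 : HasDerivAt (fun t : ℝ => θ - t • g) (-g) t := by
      simpa using ((hasDerivAt_id t).smul_const g).const_sub θ
    have h2 := (hdiff (θ - t • g)).hasGradientAt.hasFDerivAt
    have h3 := h2.comp_hasDerivAt t h1
    simpa [Function.comp_def, inner_neg_right] using h3
  have hB : ∀ t : ℝ, HasDerivAt
      (fun t : ℝ => f θ - t * inner ℝ (gradient f θ) g + L * ‖g‖ ^ 2 / 2 * t ^ 2)
      (-(inner ℝ (gradient f θ) g) + L * ‖g‖ ^ 2 * t) t := by
    intro t
    have h1 := (((hasDerivAt_id t).mul_const (inner ℝ (gradient f θ) g)).const_sub (f θ)).add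
      ((hasDerivAt_pow 2 t).const_mul (L * ‖g‖ ^ 2 / 2))
    refine h1.congr_deriv ?_
    push_cast
    ring
  have key := image_le_of_deriv_right_le_deriv_boundary (a := 0) (b := η)
    (fun t _ => (hc t).continuousAt.continuousWithinAt)
    (fun t _ => (hc t).hasDerivWithinAt) (by simp)
    (fun t _ => (hB t).continuousAt.continuousWithinAt)
    (fun t _ => (hB t).hasDerivWithinAt)
    (by
      intro t ht
      have h1 := real_inner_le_norm (gradient f θ - gradient f (θ - t • g)) g
      have h2 := hlip θ (θ - t • g)
      rw [sub_sub_cancel, norm_smul, Real.norm_of_nonneg ht.1] at h2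
      have h3 := mul_le_mul_of_nonneg_right h2 (norm_nonneg g)
      rw [inner_sub_left] at h1
      nlinarith)
    (Set.right_mem_Icc.2 hη.le)
  have hn := norm_sub_sq_real (gradient f θ) g
  rw [hn]
  nlinarith
end
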